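/- arXiv:1612.09258 — 7 statements merged into one kernel-verified Lean document; each statement's English description precedes it below -/
import Mathlib

section
/- Let k be a field, G a group, S ⊆ G∖{e} a subset closed under conjugation, C̄ ⊆ S, and R : S → ℕ with R(c) ≥ 1 for c ∈ C̄, constant on conjugacy classes. Let W be the free k-module on the set of triples B = {(x, c, i) : x ∈ G, c ∈ S, 1 ≤ i ≤ R(c)} (representing the labelled arrow x →^{(i)} xc). Suppose given: the left G-action g·(x,c,i) = (gx, c, i) extended linearly, and for each g ∈ G a k-linear map w ↦ w·g on W such that (x,c,i)·g lies in the span of {(xg, g⁻¹cg, j) : 1 ≤ j ≤ R(c)} and, when c ∈ C̄, the coefficient of (xg, g⁻¹cg, 1) in (x,c,i)·g equals δ_{i,1}. Define the k-linear map i : W → kG into the group algebra by i(x, c, 1) = xc − x for c ∈ C̄ and i(x,c,j) = 0 otherwise (j ≠ 1 or c ∉ C̄). Then: (1) i(g·w) = g·i(w) and i(w·g) = i(w)·g in kG for all w ∈ W, g ∈ G (i is a kG-bimodule map); (2) writing Δ for the coproduct of kG (Δ(g) = g⊗g), Δ_L(x,c,i) = x ⊗ (x,c,i) ∈ kG⊗W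 and Δ_R(x,c,i) = (x,c,i) ⊗ xc ∈ W⊗kG, one has Δ(i(w)) = (i⊗id)(Δ_R w) + (id⊗i)(Δ_L w) for all w ∈ W (the co-Leibniz rule). -/
open scoped TensorProduct

/-- The index set of the labelled arrows `x →^{(i)} xc` of the coloured Hopf quiver
`Q(G, R)` restricted to the set `S` of allowed steps: triples `(x, c, i)` with
`c ∈ S` and `1 ≤ i ≤ R c`. -/
abbrev ArrowIdx {G : Type*} (S : Set G) (R : G → ℕ) : Type _ :=
  {p : G × G × ℕ // p.2.1 ∈ S ∧ 1 ≤ p.2.2 ∧ p.2.2 ≤ R p.2.1}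

/-- Quiver codifferential calculus on a group algebra `kG`.
`W` is the free `k`-module on the labelled arrows of the Hopf quiver, with left
`G`-action `g·(x,c,i) = (gx,c,i)`, a right action sending `(x,c,i)·g` into the span
of `{(xg, g⁻¹cg, j)}` with coefficient `δ_{i,1}` at `(xg, g⁻¹cg, 1)` when `c ∈ C̄`,
and codifferential `i(x,c,1) = xc - x` for `c ∈ C̄`, `i = 0` otherwise.  Then `i` is
a `kG`-bimodule map and satisfies the co-Leibniz rule
`Δ ∘ i = (i ⊗ id) ∘ Δ_R + (id ⊗ i) ∘ Δ_L`. -/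
theorem statement_4 {k : Type*} [Field k] {G : Type*} [Group G]
    (S : Set G) (hS_ne : ∀ a ∈ S, a ≠ 1)
    (hS_conj : ∀ a ∈ S, ∀ h : G, h * a * h⁻¹ ∈ S)
    (Cbar : Set G) (hCbar_sub : Cbar ⊆ S)
    (hCbar_conj : ∀ a ∈ Cbar, ∀ h : G, h * a * h⁻¹ ∈ Cbar)
    (R : G → ℕ) (hR_pos : ∀ c ∈ Cbar, 1 ≤ R c)
    (hR_conj : ∀ c ∈ S, ∀ h : G, R (h * c * h⁻¹) = R c)
    (L Rt : G → (ArrowIdx S R →₀ k) →ₗ[k] (ArrowIdx S R →₀ k))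
    (hL : ∀ (g : G) (b : ArrowIdx S R),
      L g (Finsupp.single b 1) =
        Finsupp.single ⟨(g * b.1.1, b.1.2.1, b.1.2.2), b.2⟩ 1)
    (hRt_supp : ∀ (g : G) (b q : ArrowIdx S R),
      Rt g (Finsupp.single b 1) q ≠ 0 →
        q.1.1 = b.1.1 * g ∧ q.1.2.1 = g⁻¹ * b.1.2.1 * g)
    (hRt_coeff : ∀ (g : G) (b : ArrowIdx S R), b.1.2.1 ∈ Cbar →
      ∀ q : ArrowIdx S R, q.1 = (b.1.1 * g, g⁻¹ * b.1.2.1 * g, 1) →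
        Rt g (Finsupp.single b 1) q = if b.1.2.2 = 1 then 1 else 0)
    (ii : (ArrowIdx S R →₀ k) →ₗ[k] MonoidAlgebra k G)
    (hii_one : ∀ b : ArrowIdx S R, b.1.2.2 = 1 → b.1.2.1 ∈ Cbar →
      ii (Finsupp.single b 1) =
        MonoidAlgebra.single (b.1.1 * b.1.2.1) 1 - MonoidAlgebra.single b.1.1 1)
    (hii_zero : ∀ b : ArrowIdx S R, b.1.2.2 ≠ 1 ∨ b.1.2.1 ∉ Cbar →
      ii (Finsupp.single b 1) = 0)
    (ΔL : (ArrowIdx S R →₀ k) →ₗ[k] MonoidAlgebra k G ⊗[k] (ArrowIdx S R →₀ k))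
    (hΔL : ∀ b : ArrowIdx S R, ΔL (Finsupp.single b 1) =
      MonoidAlgebra.single b.1.1 1 ⊗ₜ[k] Finsupp.single b 1)
    (ΔR : (ArrowIdx S R →₀ k) →ₗ[k] (ArrowIdx S R →₀ k) ⊗[k] MonoidAlgebra k G)
    (hΔR : ∀ b : ArrowIdx S R, ΔR (Finsupp.single b 1) =
      Finsupp.single b 1 ⊗ₜ[k] MonoidAlgebra.single (b.1.1 * b.1.2.1) 1)
    (Δ : MonoidAlgebra k G →ₗ[k] MonoidAlgebra k G ⊗[k] MonoidAlgebra k G)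
    (hΔ : ∀ g : G, Δ (MonoidAlgebra.single g 1) =
      MonoidAlgebra.single g 1 ⊗ₜ[k] MonoidAlgebra.single g 1) :
    (∀ (g : G) (w : ArrowIdx S R →₀ k),
      ii (L g w) = MonoidAlgebra.single g 1 * ii w ∧
      ii (Rt g w) = ii w * MonoidAlgebra.single g 1) ∧
    (∀ w : ArrowIdx S R →₀ k,
      Δ (ii w) = (TensorProduct.map ii LinearMap.id) (ΔR w) +
        (TensorProduct.map LinearMap.id ii) (ΔL w)) := by
  have hext : ∀ {M : Type _} [AddCommGroup M] [Module k M]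
      (f f' : (ArrowIdx S R →₀ k) →ₗ[k] M),
      (∀ b, f (Finsupp.single b 1) = f' (Finsupp.single b 1)) → ∀ w, f w = f' w := by
    intro M _ _ f f' h w
    have : f = f' := by
      apply Finsupp.lhom_ext'
      intro b
      apply LinearMap.ext_ring
      simpa using h b
    rw [this]
  have hexp : ∀ v : ArrowIdx S R →₀ k,
      ii v = v.sum fun q a => a • ii (Finsupp.single q 1) := by
    intro v
    conv_lhs => rw [← Finsupp.sum_single v]
    rw [Finsupp.sum, map_sum, Finsupp.sum]
    refine Finset.sum_congr rfl fun q _ => ?_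
    rw [← map_smul, Finsupp.smul_single, smul_eq_mul, mul_one]
  have hconj : ∀ (g c : G), g⁻¹ * c * g ∈ Cbar ↔ c ∈ Cbar := by
    intro g c
    constructor
    · intro h
      have := hCbar_conj _ h g
      simpa [mul_assoc] using this
    · intro h
      simpa using hCbar_conj _ h g⁻¹
  refine ⟨fun g w => ⟨?_, ?_⟩, fun w => ?_⟩
  · refine hext (ii ∘ₗ L g) (LinearMap.mulLeft k (MonoidAlgebra.single g 1) ∘ₗ ii) ?_ w
    intro b
    simp only [LinearMap.comp_apply, LinearMap.mulLeft_apply, hL]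
    by_cases h : b.1.2.2 = 1 ∧ b.1.2.1 ∈ Cbar
    · rw [hii_one b h.1 h.2, hii_one ⟨(g * b.1.1, b.1.2.1, b.1.2.2), b.2⟩ h.1 h.2]
      simp [mul_sub, MonoidAlgebra.single_mul_single, mul_assoc]
    · have h' : b.1.2.2 ≠ 1 ∨ b.1.2.1 ∉ Cbar := by tauto
      rw [hii_zero b h', hii_zero ⟨(g * b.1.1, b.1.2.1, b.1.2.2), b.2⟩ h', mul_zero]
  · refine hext (ii ∘ₗ Rt g) (LinearMap.mulRight k (MonoidAlgebra.single g 1) ∘ₗ ii) ?_ w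
    intro b
    simp only [LinearMap.comp_apply, LinearMap.mulRight_apply]
    rw [hexp (Rt g _)]
    by_cases hc : b.1.2.1 ∈ Cbar
    · have hc' := (hconj g b.1.2.1).2 hc
      let q0 : ArrowIdx S R := ⟨(b.1.1 * g, g⁻¹ * b.1.2.1 * g, 1),
        hCbar_sub hc', le_refl _, hR_pos _ hc'⟩
      have hq0 := hRt_coeff g b hc q0 rfl
      rw [Finsupp.sum, Finset.sum_eq_single q0]
      · rw [hq0, hii_one q0 rfl hc']
        by_cases h1 : b.1.2.2 = 1
        · rw [hii_one b h1 hc]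
          simp [h1, q0, sub_mul, MonoidAlgebra.single_mul_single, mul_assoc]
        · rw [hii_zero b (Or.inl h1)]
          simp [h1]
      · intro q hq hne
        have hs := hRt_supp g b q (Finsupp.mem_support_iff.1 hq)
        rw [hii_zero q, smul_zero]
        left
        intro h1
        exact hne (Subtype.ext (Prod.ext hs.1 (Prod.ext hs.2 h1)))
      · intro h
        rw [Finsupp.notMem_support_iff.1 h, zero_smul]
    · rw [hii_zero b (Or.inr hc), zero_mul, Finsupp.sum]
      refine Finset.sum_eq_zero fun q hq => ?_
      have hs := hRt_supp g b q (Finsupp.mem_support_iff.1 hq)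
      rw [hii_zero q, smul_zero]
      right
      rw [hs.2, hconj]
      exact hc
  · refine hext (Δ ∘ₗ ii) (TensorProduct.map ii LinearMap.id ∘ₗ ΔR +
      TensorProduct.map LinearMap.id ii ∘ₗ ΔL) ?_ w
    intro b
    simp only [LinearMap.comp_apply, LinearMap.add_apply, hΔL, hΔR, TensorProduct.map_tmul,
      LinearMap.id_apply]
    by_cases h : b.1.2.2 = 1 ∧ b.1.2.1 ∈ Cbar
    · rw [hii_one b h.1 h.2, map_sub, hΔ, hΔ, TensorProduct.sub_tmul, TensorProduct.tmul_sub]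
      abel
    · have h' : b.1.2.2 ≠ 1 ∨ b.1.2.1 ∉ Cbar := by tauto
      rw [hii_zero b h', map_zero, TensorProduct.zero_tmul, TensorProduct.tmul_zero, add_zero]
end

section
/- Let k be a field, G a group, g ∈ G, and c : G → k a finitely supported function with c(e) = 0. If Σ_{h∈G, h≠e} c(h)·((h − e) ⊗ (g − h)) = 0 in kG ⊗_k kG (where e denotes the identity element viewed in the group algebra kG), then c(h) = 0 for every h ∉ {e, g}; consequently Σ_{h≠e} c(h)(h − e) = c(g)(g − e). -/
open scoped TensorProduct

/-- Let `kG` be the group algebra of a group `G` over a field `k`,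
`g ∈ G`, and `c : G → k` finitely supported with `c e = 0`.  If
`∑_{h ≠ e} c h • ((h - e) ⊗ (g - h)) = 0` in `kG ⊗_k kG`, then `c h = 0` for every
`h ∉ {e, g}`; consequently `∑_{h ≠ e} c h • (h - e) = c g • (g - e)`. -/
theorem statement_5 {k : Type*} [Field k] {G : Type*} [Group G]
    (g : G) (c : G →₀ k) (hce : c 1 = 0)
    (hsum : (c.sum fun h ch =>
        ch • ((MonoidAlgebra.single h (1 : k) - MonoidAlgebra.single 1 1) ⊗ₜ[k]
          (MonoidAlgebra.single g (1 : k) - MonoidAlgebra.single h 1))) = 0) :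
    (∀ h : G, h ≠ 1 → h ≠ g → c h = 0) ∧
    (c.sum fun h ch => ch • (MonoidAlgebra.single h (1 : k) - MonoidAlgebra.single 1 1)) =
      c g • (MonoidAlgebra.single g (1 : k) - MonoidAlgebra.single 1 1) := by
  have key : ∀ h : G, h ≠ 1 → h ≠ g → c h = 0 := by
    classical
    intro h0 h1 hg
    let δ : MonoidAlgebra k G →ₗ[k] k :=
      { toFun := fun x => x.coeff h0
        map_add' := fun x y => by simp
        map_smul' := fun a x => by simp }
    have hδ : ∀ h : G, δ (MonoidAlgebra.single h (1 : k)) = if h = h0 then 1 else 0 := by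
      intro h
      change (MonoidAlgebra.single h (1 : k)).coeff h0 = _
      rw [MonoidAlgebra.coeff_single, Finsupp.single_apply]
    have := congrArg ((LinearMap.mul' k k) ∘ₗ (TensorProduct.map δ δ)) hsum
    rw [Finsupp.sum, map_sum] at this
    simp only [map_smul, LinearMap.comp_apply, TensorProduct.map_tmul, map_sub, hδ,
      LinearMap.mul'_apply, map_zero, if_neg h1.symm, if_neg hg.symm] at this
    simpa using this
  refine ⟨key, ?_⟩
  rw [Finsupp.sum, Finset.sum_eq_single g]
  · intro h _ hg
    by_cases h1 : h = 1
    · simp [h1]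
    · simp [key h h1 hg]
  · intro hg
    simp [Finsupp.notMem_support_iff.mp hg]
end

section
/- Let k be a field and Q a finite quiver with vertex set Q₀ and arrow set Q₁, with source and target maps s, t. Let A = k(Q₀) be the k-algebra of functions Q₀ → k with pointwise operations, and let Ω = kQ₁ be the free k-module on Q₁ with A-bimodule structure f·α = f(s(α))α and α·f = f(t(α))α for f ∈ A and arrows α. Form Ω ⊗_A Ω (the tensor product over A balancing the right action on the first factor against the left action on the second; it has basis the composable pairs of arrows). Then there exist an element g ∈ Ω ⊗_A Ω and an A-bimodule map (·,·) : Ω ⊗_A Ω → A such that g is central (f·g = g·f for all f ∈ A) and g⁽¹⁾ ⊗ (g⁽²⁾, ω) = ω and (ω, g⁽¹⁾) ⊗ g⁽²⁾ = ω for all ω ∈ Ω (writing g = g⁽¹⁾⊗g⁽²⁾), if and only if the quiver is symmetric, i.e. for every pair of vertices x, y the number of arrows from x to y equals the number of arrows from y to x. In that case the possible metrics g are exactly those of the form g = Σ_{x→y} Σ_{i,j} g^{ij}_{x→y} (x →^{(i)} y) ⊗ (y →^{(j)} x) with each coefficient matrix (g^{ij}_{x→y}) invertible. -/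
noncomputable section

/-- The composable pairs of arrows of a quiver with arrow set `E` and source/target
maps `s, t` — a basis of `Ω ⊗_A Ω` for the quiver calculus. -/
abbrev CompPair {V E : Type*} (s t : E → V) : Type _ := {p : E × E // t p.1 = s p.2}

/-- The basis 1-form attached to an arrow `α`. -/
def basisArrow (k : Type*) [Field k] {E : Type*} [DecidableEq E] (α : E) : E → k :=
  fun e => if e = α then 1 else 0

/-- The balanced tensor product `ω ⊗_A η` of two 1-forms, as an element of the free
module on composable pairs. -/
def tenQ {k V E : Type*} [Field k] (s t : E → V) (ω η : E → k) :
    CompPair s t → k :=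
  fun p => ω p.1.1 * η p.1.2

/-- Left action of `A = k(Q₀)` on 2-tensors. -/
def lact {k V E : Type*} [Field k] (s t : E → V) (f : V → k)
    (w : CompPair s t → k) : CompPair s t → k :=
  fun p => f (s p.1.1) * w p

/-- Right action of `A = k(Q₀)` on 2-tensors. -/
def ract {k V E : Type*} [Field k] (s t : E → V) (w : CompPair s t → k)
    (f : V → k) : CompPair s t → k :=
  fun p => w p * f (t p.1.2)

/-- The 1-form `g⁽¹⁾ ⊗ (g⁽²⁾, ω)`, where `(·,·)` is the inverse metric `B`. -/
def metric1 {k V E : Type*} [Field k] [Fintype E] [DecidableEq V] [DecidableEq E]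
    (s t : E → V) (B : (CompPair s t → k) →ₗ[k] (V → k))
    (g : CompPair s t → k) (ω : E → k) : E → k :=
  fun α => ∑ p : CompPair s t,
    if p.1.1 = α then g p * (B (tenQ s t (basisArrow k p.1.2) ω)) (t α) else 0

/-- The 1-form `(ω, g⁽¹⁾) ⊗ g⁽²⁾`, where `(·,·)` is the inverse metric `B`. -/
def metric2 {k V E : Type*} [Field k] [Fintype E] [DecidableEq V] [DecidableEq E]
    (s t : E → V) (B : (CompPair s t → k) →ₗ[k] (V → k))
    (g : CompPair s t → k) (ω : E → k) : E → k :=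
  fun β => ∑ p : CompPair s t,
    if p.1.2 = β then (B (tenQ s t ω (basisArrow k p.1.1))) (s β) * g p else 0

def extG {k V E : Type*} [Field k] [DecidableEq V] (s t : E → V)
    (g : CompPair s t → k) : Matrix E E k :=
  fun a b => if h : t a = s b then g ⟨(a, b), h⟩ else 0

def formM {k V E : Type*} [Field k] [DecidableEq E] (s t : E → V)
    (B : (CompPair s t → k) →ₗ[k] (V → k)) : Matrix E E k :=
  fun a b => B (tenQ s t (basisArrow k a) (basisArrow k b)) (s a)

theorem sum_pair_fst {k V E : Type*} [Field k] [Fintype E] [DecidableEq V] [DecidableEq E]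
    (s t : E → V) (F : CompPair s t → k) (α : E) :
    (∑ p : CompPair s t, if p.1.1 = α then F p else 0) =
      ∑ b : E, if h : t α = s b then F ⟨(α, b), h⟩ else 0 := by
  have h1 : (∑ p : CompPair s t, if p.1.1 = α then F p else 0) =
      ∑ q : E × E, if h : t q.1 = s q.2 then (if q.1 = α then F ⟨q, h⟩ else 0) else 0 := by
    rw [← Finset.sum_subset (Finset.subset_univ (Finset.univ.filter
      (fun q : E × E => t q.1 = s q.2)))]
    · rw [Finset.sum_subtype (p := fun q : E × E => t q.1 = s q.2) _ (by simp)]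
      refine Finset.sum_congr rfl fun p _ => ?_
      rw [dif_pos p.2]
    · intro q _ hq
      simp at hq
      simp [hq]
  rw [h1, Fintype.sum_prod_type, Finset.sum_eq_single α]
  · simp
  · intro a _ ha
    simp [ha]
  · simp

theorem sum_pair_snd {k V E : Type*} [Field k] [Fintype E] [DecidableEq V] [DecidableEq E]
    (s t : E → V) (F : CompPair s t → k) (β : E) :
    (∑ p : CompPair s t, if p.1.2 = β then F p else 0) =
      ∑ a : E, if h : t a = s β then F ⟨(a, β), h⟩ else 0 := by
  have h1 : (∑ p : CompPair s t, if p.1.2 = β then F p else 0) =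
      ∑ q : E × E, if h : t q.1 = s q.2 then (if q.2 = β then F ⟨q, h⟩ else 0) else 0 := by
    rw [← Finset.sum_subset (Finset.subset_univ (Finset.univ.filter
      (fun q : E × E => t q.1 = s q.2)))]
    · rw [Finset.sum_subtype (p := fun q : E × E => t q.1 = s q.2) _ (by simp)]
      refine Finset.sum_congr rfl fun p _ => ?_
      rw [dif_pos p.2]
    · intro q _ hq
      simp at hq
      simp [hq]
  rw [h1, Fintype.sum_prod_type_right, Finset.sum_eq_single β]
  · simp
  · intro a _ ha
    simp [ha]
  · simp

theorem ten_right {k V E : Type*} [Field k] [Fintype E] [DecidableEq E]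
    (s t : E → V) (η ω : E → k) :
    tenQ s t η ω = ∑ c, ω c • tenQ s t η (basisArrow k c) := by
  funext p
  simp [tenQ, basisArrow, Finset.sum_apply, mul_comm]

theorem ten_left {k V E : Type*} [Field k] [Fintype E] [DecidableEq E]
    (s t : E → V) (η ω : E → k) :
    tenQ s t ω η = ∑ c, ω c • tenQ s t (basisArrow k c) η := by
  funext p
  simp [tenQ, basisArrow, Finset.sum_apply]

theorem form_left {k V E : Type*} [Field k] [DecidableEq V] [DecidableEq E]
    (s t : E → V) (B : (CompPair s t → k) →ₗ[k] (V → k))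
    (hl : ∀ (f : V → k) (w : CompPair s t → k), B (lact s t f w) = f * B w)
    (a b : E) (v : V) (h : v ≠ s a) :
    B (tenQ s t (basisArrow k a) (basisArrow k b)) v = 0 := by
  have h1 := hl (Pi.single v 1) (tenQ s t (basisArrow k a) (basisArrow k b))
  have h2 : lact s t (Pi.single v 1) (tenQ s t (basisArrow k a) (basisArrow k b)) = 0 := by
    funext p
    by_cases hp : p.1.1 = a
    · have : s p.1.1 ≠ v := by rw [hp]; exact h.symm
      simp [lact, this]
    · simp [lact, tenQ, basisArrow, hp]
  rw [h2, map_zero] at h1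
  have := congrFun h1 v
  simpa using this.symm

theorem form_right {k V E : Type*} [Field k] [DecidableEq V] [DecidableEq E]
    (s t : E → V) (B : (CompPair s t → k) →ₗ[k] (V → k))
    (hr : ∀ (f : V → k) (w : CompPair s t → k), B (ract s t w f) = B w * f)
    (a b : E) (v : V) (h : v ≠ t b) :
    B (tenQ s t (basisArrow k a) (basisArrow k b)) v = 0 := by
  have h1 := hr (Pi.single v 1) (tenQ s t (basisArrow k a) (basisArrow k b))
  have h2 : ract s t (tenQ s t (basisArrow k a) (basisArrow k b)) (Pi.single v 1) = 0 := by
    funext p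
    by_cases hp : p.1.2 = b
    · have : t p.1.2 ≠ v := by rw [hp]; exact h.symm
      simp [ract, this]
    · simp [ract, tenQ, basisArrow, hp]
  rw [h2, map_zero] at h1
  have := congrFun h1 v
  simpa using this.symm

theorem form_swap {k V E : Type*} [Field k] [DecidableEq V] [DecidableEq E]
    (s t : E → V) (B : (CompPair s t → k) →ₗ[k] (V → k))
    (hl : ∀ (f : V → k) (w : CompPair s t → k), B (lact s t f w) = f * B w)
    (hr : ∀ (f : V → k) (w : CompPair s t → k), B (ract s t w f) = B w * f)
    (a b : E) :
    B (tenQ s t (basisArrow k a) (basisArrow k b)) (t b) = formM s t B a b := by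
  unfold formM
  by_cases h : t b = s a
  · rw [h]
  · rw [form_left s t B hl a b _ h, form_right s t B hr a b _ (Ne.symm h)]

theorem metric1_eq {k V E : Type*} [Field k] [Fintype E] [DecidableEq V] [DecidableEq E]
    (s t : E → V) (B : (CompPair s t → k) →ₗ[k] (V → k))
    (g : CompPair s t → k) (ω : E → k) :
    metric1 s t B g ω = Matrix.mulVec (extG s t g * formM s t B) ω := by
  rw [← Matrix.mulVec_mulVec]
  funext α
  unfold metric1
  rw [sum_pair_fst s t (fun p => g p * (B (tenQ s t (basisArrow k p.1.2) ω)) (t α))]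
  refine Finset.sum_congr rfl fun b _ => ?_
  by_cases h : t α = s b
  · simp only [h, extG, dite_true]
    congr 1
    rw [ten_right, map_sum, Finset.sum_apply]
    refine Finset.sum_congr rfl fun c _ => ?_
    simp [formM, mul_comm]
  · simp [h, extG]

theorem metric2_eq {k V E : Type*} [Field k] [Fintype E] [DecidableEq V] [DecidableEq E]
    (s t : E → V) (B : (CompPair s t → k) →ₗ[k] (V → k))
    (hl : ∀ (f : V → k) (w : CompPair s t → k), B (lact s t f w) = f * B w)
    (hr : ∀ (f : V → k) (w : CompPair s t → k), B (ract s t w f) = B w * f)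
    (g : CompPair s t → k) (ω : E → k) :
    metric2 s t B g ω = Matrix.vecMul ω (formM s t B * extG s t g) := by
  rw [← Matrix.vecMul_vecMul]
  funext β
  unfold metric2
  rw [sum_pair_snd s t (fun p => (B (tenQ s t ω (basisArrow k p.1.1))) (s β) * g p)]
  refine Finset.sum_congr rfl fun a _ => ?_
  by_cases h : t a = s β
  · simp only [h, extG, dite_true]
    congr 1
    rw [ten_left, map_sum, Finset.sum_apply]
    refine Finset.sum_congr rfl fun c _ => ?_
    have e := form_swap s t B hl hr c a
    rw [h] at e
    rw [map_smul, Pi.smul_apply, e, smul_eq_mul]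
  · simp [h, extG]

theorem sum_sub {k E : Type*} [Field k] [Fintype E] (P : E → Prop) [DecidablePred P]
    (F : E → k) (h : ∀ b, ¬ P b → F b = 0) :
    ∑ j : {e : E // P e}, F j.1 = ∑ b, F b := by
  rw [← Finset.sum_subset (Finset.subset_univ (Finset.univ.filter P))]
  · rw [Finset.sum_subtype (p := P) _ (by simp)]
  · intro q _ hq
    simp at hq
    exact h q hq

theorem main_fwd {k : Type*} [Field k] {V E : Type*} [Fintype E]
    [DecidableEq V] [DecidableEq E] (s t : E → V) (g : CompPair s t → k)
    (B : (CompPair s t → k) →ₗ[k] (V → k))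
    (hl : ∀ (f : V → k) (w : CompPair s t → k), B (lact s t f w) = f * B w)
    (hr : ∀ (f : V → k) (w : CompPair s t → k), B (ract s t w f) = B w * f)
    (hc : ∀ f : V → k, lact s t f g = ract s t g f)
    (h1 : ∀ ω : E → k, metric1 s t B g ω = ω)
    (h2 : ∀ ω : E → k, metric2 s t B g ω = ω) :
    (∀ p : CompPair s t, g p ≠ 0 → s p.1.1 = t p.1.2) ∧
         ∀ x y : V,
           ∃ N : Matrix {e : E // s e = y ∧ t e = x} {e : E // s e = x ∧ t e = y} k,
             (Matrix.of fun (i : {e : E // s e = x ∧ t e = y})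
                 (j : {e : E // s e = y ∧ t e = x}) =>
                 g ⟨(i.1, j.1), i.2.2.trans j.2.1.symm⟩) * N = 1 ∧
             N * (Matrix.of fun (i : {e : E // s e = x ∧ t e = y})
                 (j : {e : E // s e = y ∧ t e = x}) =>
                 g ⟨(i.1, j.1), i.2.2.trans j.2.1.symm⟩) = 1 := by
  have hs : ∀ p : CompPair s t, g p ≠ 0 → s p.1.1 = t p.1.2 := by
    intro p hp
    by_contra hne
    have := congrFun (hc (Pi.single (s p.1.1) 1)) p
    simp [lact, ract, Ne.symm hne] at this
    exact hp this
  refine ⟨hs, fun x y => ?_⟩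
  have hG : ∀ a b, ¬ (t a = s b ∧ s a = t b) → extG s t g a b = 0 := by
    intro a b hab
    unfold extG
    split_ifs with h
    · by_contra h0
      exact hab ⟨h, hs _ h0⟩
    · rfl
  have m1 : extG s t g * formM s t B = 1 := by
    apply Matrix.ext_of_mulVec_single
    intro i
    rw [← metric1_eq, h1, Matrix.one_mulVec]
  have m2 : formM s t B * extG s t g = 1 := by
    apply Matrix.ext_of_single_vecMul
    intro i
    rw [← metric2_eq s t B hl hr, h2, Matrix.vecMul_one]
  refine ⟨Matrix.of fun j i => formM s t B j.1 i.1, ?_, ?_⟩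
  · ext i i'
    have := congrFun (congrFun m1 i.1) i'.1
    rw [Matrix.mul_apply, ← sum_sub (fun e => s e = y ∧ t e = x)] at this
    · rw [Matrix.mul_apply]
      have e : (1 : Matrix E E k) i.1 i'.1 = (1 : Matrix {e : E // s e = x ∧ t e = y} _ k) i i' := by
        simp [Matrix.one_apply, Subtype.ext_iff]
      rw [← e, ← this]
      refine Finset.sum_congr rfl fun j _ => ?_
      simp [extG, i.2.2, j.2.1]
    · intro b hb
      rw [hG, zero_mul]
      rintro ⟨h, h'⟩
      exact hb ⟨h.symm.trans i.2.2, h'.symm.trans i.2.1⟩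
  · ext i i'
    have := congrFun (congrFun m2 i.1) i'.1
    rw [Matrix.mul_apply, ← sum_sub (fun e => s e = x ∧ t e = y)] at this
    · rw [Matrix.mul_apply]
      have e : (1 : Matrix E E k) i.1 i'.1 = (1 : Matrix {e : E // s e = y ∧ t e = x} _ k) i i' := by
        simp [Matrix.one_apply, Subtype.ext_iff]
      rw [← e, ← this]
      refine Finset.sum_congr rfl fun j _ => ?_
      simp [extG, i'.2.1, j.2.2]
    · intro b hb
      rw [hG, mul_zero]
      rintro ⟨h, h'⟩
      exact hb ⟨h'.trans i'.2.2, h.trans i'.2.1⟩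

def mkB {k V E : Type*} [Field k] [Fintype E] [DecidableEq V] (s t : E → V)
    (n : E → E → k) : (CompPair s t → k) →ₗ[k] (V → k) where
  toFun w := fun v => ∑ p : CompPair s t, if s p.1.1 = v then w p * n p.1.1 p.1.2 else 0
  map_add' w w' := by
    funext v
    simp only [Pi.add_apply, ← Finset.sum_add_distrib]
    refine Finset.sum_congr rfl fun p _ => ?_
    split_ifs <;> ring
  map_smul' c w := by
    funext v
    simp only [Pi.smul_apply, smul_eq_mul, RingHom.id_apply, Finset.mul_sum]
    refine Finset.sum_congr rfl fun p _ => ?_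
    split_ifs <;> ring

theorem main_bwd {k : Type*} [Field k] {V E : Type*} [Fintype E]
    [DecidableEq V] [DecidableEq E] (s t : E → V) (g : CompPair s t → k)
    (hs : ∀ p : CompPair s t, g p ≠ 0 → s p.1.1 = t p.1.2)
    (hN : ∀ x y : V,
           ∃ N : Matrix {e : E // s e = y ∧ t e = x} {e : E // s e = x ∧ t e = y} k,
             (Matrix.of fun (i : {e : E // s e = x ∧ t e = y})
                 (j : {e : E // s e = y ∧ t e = x}) =>
                 g ⟨(i.1, j.1), i.2.2.trans j.2.1.symm⟩) * N = 1 ∧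
             N * (Matrix.of fun (i : {e : E // s e = x ∧ t e = y})
                 (j : {e : E // s e = y ∧ t e = x}) =>
                 g ⟨(i.1, j.1), i.2.2.trans j.2.1.symm⟩) = 1) :
    ∃ B : (CompPair s t → k) →ₗ[k] (V → k),
          (∀ (f : V → k) (w : CompPair s t → k), B (lact s t f w) = f * B w) ∧
          (∀ (f : V → k) (w : CompPair s t → k), B (ract s t w f) = B w * f) ∧
          (∀ f : V → k, lact s t f g = ract s t g f) ∧
          (∀ ω : E → k, metric1 s t B g ω = ω) ∧
          (∀ ω : E → k, metric2 s t B g ω = ω) := by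
  choose N hN1 hN2 using hN
  have hG : ∀ a b, ¬ (t a = s b ∧ s a = t b) → extG s t g a b = 0 := by
    intro a b hab
    unfold extG
    split_ifs with h
    · by_contra h0
      exact hab ⟨h, hs _ h0⟩
    · rfl
  obtain ⟨n, hn⟩ : ∃ n : E → E → k, n = fun a b =>
    if h : t a = s b ∧ s a = t b then N (s b) (t b) ⟨a, h.2, h.1⟩ ⟨b, rfl, rfl⟩ else 0 := ⟨_, rfl⟩
  have hn0 : ∀ a b, ¬ (t a = s b ∧ s a = t b) → n a b = 0 := by
    intro a b hab
    simp [hn, hab]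
  have hn1 : ∀ x y j i, N x y j i = n j.1 i.1 := by
    rintro x y ⟨j, hj⟩ ⟨i, rfl, rfl⟩
    simp [hn, hj]
  have hl : ∀ (f : V → k) (w : CompPair s t → k), mkB s t n (lact s t f w) = f * mkB s t n w := by
    intro f w
    funext v
    simp only [mkB, LinearMap.coe_mk, AddHom.coe_mk, Pi.mul_apply, Finset.mul_sum]
    refine Finset.sum_congr rfl fun p _ => ?_
    split_ifs with h
    · rw [lact, h]; ring
    · simp
  have hr : ∀ (f : V → k) (w : CompPair s t → k), mkB s t n (ract s t w f) = mkB s t n w * f := by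
    intro f w
    funext v
    simp only [mkB, LinearMap.coe_mk, AddHom.coe_mk, Pi.mul_apply, Finset.sum_mul]
    refine Finset.sum_congr rfl fun p _ => ?_
    split_ifs with h
    · by_cases h' : s p.1.1 = t p.1.2
      · rw [ract, ← h', h]; ring
      · rw [hn0 _ _ (fun hh => h' hh.2)]; simp
    · simp
  have hF : formM s t (mkB s t n) = Matrix.of n := by
    ext a b
    simp only [formM, mkB, LinearMap.coe_mk, AddHom.coe_mk, Matrix.of_apply]
    have : ∀ p : CompPair s t, (if s p.1.1 = s a then
        tenQ s t (basisArrow k a) (basisArrow k b) p * n p.1.1 p.1.2 else 0) =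
        if p.1.1 = a then (if p.1.2 = b then n a b else 0) else 0 := by
      intro p
      by_cases h1 : p.1.1 = a <;> by_cases h2 : p.1.2 = b <;> simp [tenQ, basisArrow, h1, h2]
    simp only [this]
    rw [sum_pair_fst s t (fun p => if p.1.2 = b then n a b else 0), Finset.sum_eq_single b]
    · by_cases h : t a = s b
      · simp [h]
      · simp [h, hn0 a b (fun hh => h hh.1)]
    · intro c _ hc
      simp [hc]
    · simp
  have m1 : extG s t g * Matrix.of n = 1 := by
    ext a c
    rw [Matrix.mul_apply]
    by_cases hac : s c = s a ∧ t c = t a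
    · have := Matrix.ext_iff.mpr (hN1 (s a) (t a)) ⟨a, rfl, rfl⟩ ⟨c, hac⟩
      have e : (1 : Matrix E E k) a c =
          (1 : Matrix {e : E // s e = s a ∧ t e = t a} {e : E // s e = s a ∧ t e = t a} k) ⟨a, rfl, rfl⟩ ⟨c, hac⟩ := by
        simp [Matrix.one_apply]
      rw [e, ← this, Matrix.mul_apply, ← sum_sub (fun e => s e = t a ∧ t e = s a)]
      · refine Finset.sum_congr rfl fun j _ => ?_
        rw [hn1]
        simp [extG, j.2.1]
      · intro b hb
        rw [hG, zero_mul]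
        rintro ⟨h, h'⟩
        exact hb ⟨h.symm, h'.symm⟩
    · rw [Matrix.one_apply_ne (by rintro rfl; exact hac ⟨rfl, rfl⟩)]
      refine Finset.sum_eq_zero fun b _ => ?_
      by_cases h1 : t a = s b ∧ s a = t b
      · rw [Matrix.of_apply, hn0, mul_zero]
        rintro ⟨h, h'⟩
        exact hac ⟨by rw [← h, h1.2], by rw [← h', h1.1]⟩
      · rw [hG _ _ h1, zero_mul]
  have m2 : Matrix.of n * extG s t g = 1 := mul_eq_one_comm.mp m1
  refine ⟨mkB s t n, hl, hr, ?_, ?_, ?_⟩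
  · intro f
    funext p
    by_cases h : g p = 0
    · simp [lact, ract, h]
    · simp [lact, ract, hs p h, mul_comm]
  · intro ω
    rw [metric1_eq, hF, m1, Matrix.one_mulVec]
  · intro ω
    rw [metric2_eq s t _ hl hr, hF, m2, Matrix.vecMul_one]

theorem exists_g {k : Type*} [Field k] {V E : Type*} [Fintype E]
    [DecidableEq V] [DecidableEq E] (s t : E → V)
    (hsym : ∀ x y : V, Fintype.card {e : E // s e = x ∧ t e = y} =
        Fintype.card {e : E // s e = y ∧ t e = x}) :
    ∃ g : CompPair s t → k, (∀ p : CompPair s t, g p ≠ 0 → s p.1.1 = t p.1.2) ∧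
         ∀ x y : V,
           ∃ N : Matrix {e : E // s e = y ∧ t e = x} {e : E // s e = x ∧ t e = y} k,
             (Matrix.of fun (i : {e : E // s e = x ∧ t e = y})
                 (j : {e : E // s e = y ∧ t e = x}) =>
                 g ⟨(i.1, j.1), i.2.2.trans j.2.1.symm⟩) * N = 1 ∧
             N * (Matrix.of fun (i : {e : E // s e = x ∧ t e = y})
                 (j : {e : E // s e = y ∧ t e = x}) =>
                 g ⟨(i.1, j.1), i.2.2.trans j.2.1.symm⟩) = 1 := by
  let σ : ∀ x y : V, {e : E // s e = x ∧ t e = y} ≃ {e : E // s e = y ∧ t e = x} :=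
    fun x y => Fintype.equivOfCardEq (hsym x y)
  let τ : E → E := fun a => (σ (s a) (t a) ⟨a, rfl, rfl⟩).1
  have hτ : ∀ x y i, (σ x y i).1 = τ i.1 := by
    rintro x y ⟨i, rfl, rfl⟩
    rfl
  refine ⟨fun p => if τ p.1.1 = p.1.2 then 1 else 0, ?_, ?_⟩
  · intro p hp
    have h : τ p.1.1 = p.1.2 := by
      by_contra h
      simp [h] at hp
    rw [← h]
    exact (σ (s p.1.1) (t p.1.1) ⟨p.1.1, rfl, rfl⟩).2.2.symm
  · intro x y
    have key : (Matrix.of fun (i : {e : E // s e = x ∧ t e = y})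
        (j : {e : E // s e = y ∧ t e = x}) => if τ i.1 = j.1 then (1 : k) else 0) =
        Matrix.of fun i j => if σ x y i = j then (1 : k) else 0 := by
      ext i j
      simp [Subtype.ext_iff, hτ]
    simp only [key]
    refine ⟨Matrix.of fun j i => if σ x y i = j then (1 : k) else 0, ?_, ?_⟩
    · ext i i'
      simp [Matrix.mul_apply, Matrix.one_apply, eq_comm]
    · ext j j'
      obtain ⟨i, rfl⟩ := (σ x y).surjective j
      rw [Matrix.mul_apply, Finset.sum_eq_single i]
      · simp [Matrix.one_apply]
      · intro b _ hb
        simp [hb]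
      · simp

/-- Let `Q` be a finite quiver, `A = k(Q₀)`, `Ω = kQ₁` the quiver
bimodule.  There exist a central `g ∈ Ω ⊗_A Ω` and a bimodule map
`(·,·) : Ω ⊗_A Ω → A` with `g⁽¹⁾ ⊗ (g⁽²⁾, ω) = ω` and `(ω, g⁽¹⁾) ⊗ g⁽²⁾ = ω` for all
`ω` (a quantum metric) if and only if the quiver is symmetric (for all vertices `x, y`
the number of arrows `x → y` equals the number of arrows `y → x`).  In that case the
metrics are exactly the `g` supported on round-trip pairs (`s(g⁽¹⁾) = t(g⁽²⁾)`,
equivalently `g` central) whose coefficient matrix between each pair of opposite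
arrow sets is invertible. -/
theorem statement_7 {k : Type*} [Field k] {V E : Type*} [Fintype V] [Fintype E]
    [DecidableEq V] [DecidableEq E] (s t : E → V) :
    ((∃ (g : CompPair s t → k) (B : (CompPair s t → k) →ₗ[k] (V → k)),
        (∀ (f : V → k) (w : CompPair s t → k), B (lact s t f w) = f * B w) ∧
        (∀ (f : V → k) (w : CompPair s t → k), B (ract s t w f) = B w * f) ∧
        (∀ f : V → k, lact s t f g = ract s t g f) ∧
        (∀ ω : E → k, metric1 s t B g ω = ω) ∧
        (∀ ω : E → k, metric2 s t B g ω = ω)) ↔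
      (∀ x y : V, Fintype.card {e : E // s e = x ∧ t e = y} =
        Fintype.card {e : E // s e = y ∧ t e = x})) ∧
    ((∀ x y : V, Fintype.card {e : E // s e = x ∧ t e = y} =
        Fintype.card {e : E // s e = y ∧ t e = x}) →
      ∀ g : CompPair s t → k,
        ((∃ B : (CompPair s t → k) →ₗ[k] (V → k),
          (∀ (f : V → k) (w : CompPair s t → k), B (lact s t f w) = f * B w) ∧
          (∀ (f : V → k) (w : CompPair s t → k), B (ract s t w f) = B w * f) ∧
          (∀ f : V → k, lact s t f g = ract s t g f) ∧
          (∀ ω : E → k, metric1 s t B g ω = ω) ∧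
          (∀ ω : E → k, metric2 s t B g ω = ω)) ↔
        ((∀ p : CompPair s t, g p ≠ 0 → s p.1.1 = t p.1.2) ∧
         ∀ x y : V,
           ∃ N : Matrix {e : E // s e = y ∧ t e = x} {e : E // s e = x ∧ t e = y} k,
             (Matrix.of fun (i : {e : E // s e = x ∧ t e = y})
                 (j : {e : E // s e = y ∧ t e = x}) =>
                 g ⟨(i.1, j.1), i.2.2.trans j.2.1.symm⟩) * N = 1 ∧
             N * (Matrix.of fun (i : {e : E // s e = x ∧ t e = y})
                 (j : {e : E // s e = y ∧ t e = x}) =>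
                 g ⟨(i.1, j.1), i.2.2.trans j.2.1.symm⟩) = 1))) := by
  refine ⟨⟨?_, ?_⟩, ?_⟩
  · rintro ⟨g, B, hl, hr, hc, h1, h2⟩ x y
    obtain ⟨N, hN1, hN2⟩ := (main_fwd s t g B hl hr hc h1 h2).2 x y
    exact Matrix.square_of_invertible _ _ hN1 hN2
  · intro h
    obtain ⟨g, hg, hN⟩ := exists_g (k := k) s t h
    exact ⟨g, main_bwd s t g hg hN⟩
  · intro _ g
    constructor
    · rintro ⟨B, hl, hr, hc, h1, h2⟩
      exact main_fwd s t g B hl hr hc h1 h2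
    · rintro ⟨hg, hN⟩
      exact main_bwd s t g hg hN

end
end

section
/- Let A be an algebra over a field k, Ω an A-bimodule, θ ∈ Ω, and d : A → Ω the inner derivation d(a) = θa − aθ. (a) For any pair of A-bimodule maps σ : Ω ⊗_A Ω → Ω ⊗_A Ω and α : Ω → Ω ⊗_A Ω, the map ∇ω = θ ⊗ ω − σ(ω ⊗ θ) + α(ω) satisfies ∇(aω) = da ⊗ ω + a∇ω and ∇(ωa) = (∇ω)a + σ(ω ⊗ da) for all a ∈ A, ω ∈ Ω; hence (∇, σ) is a bimodule connection. (b) Conversely, if (∇, σ) is any bimodule connection on Ω, then the map α(ω) := ∇ω − θ ⊗ ω + σ(ω ⊗ θ) is an A-bimodule map. Thus bimodule connections (∇, σ) on the inner calculus are in one-to-one correspondence with pairs (σ, α) of bimodule maps. -/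
open MulOpposite

/-- Let `A` be an algebra over a field `k`, `Ω` an `A`-bimodule
(right action written via `Aᵐᵒᵖ`), `θ ∈ Ω`, and `d a = θa - aθ` the inner derivation.
The bimodule tensor square `Ω ⊗_A Ω` is modelled by a `k`-module `T` with a balanced
bilinear map `tens` compatible with both actions.
(a) For any `A`-bimodule maps `σ : T → T` and `α : Ω → T`, the map
`nablaω = θ ⊗ ω - σ(ω ⊗ θ) + α ω` satisfies `nabla(aω) = da ⊗ ω + anablaω` and
`nabla(ωa) = (nablaω)a + σ(ω ⊗ da)`, i.e. `(nabla, σ)` is a bimodule connection.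
(b) Conversely, for any bimodule connection `(nabla, σ)`, the map
`α ω = nablaω - θ ⊗ ω + σ(ω ⊗ θ)` is an `A`-bimodule map. -/
theorem statement_9 {k : Type*} [Field k] {A : Type*} [Ring A] [Algebra k A]
    {Ω : Type*} [AddCommGroup Ω] [Module k Ω] [Module A Ω] [Module Aᵐᵒᵖ Ω]
    [SMulCommClass A Aᵐᵒᵖ Ω]
    {T : Type*} [AddCommGroup T] [Module k T] [Module A T] [Module Aᵐᵒᵖ T]
    [SMulCommClass A Aᵐᵒᵖ T]
    (tens : Ω →ₗ[k] Ω →ₗ[k] T)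
    (htens_left : ∀ (a : A) (ω η : Ω), tens (a • ω) η = a • tens ω η)
    (htens_bal : ∀ (a : A) (ω η : Ω), tens (op a • ω) η = tens ω (a • η))
    (htens_right : ∀ (a : A) (ω η : Ω), tens ω (op a • η) = op a • tens ω η)
    (θ : Ω) (d : A → Ω) (hd : ∀ a : A, d a = op a • θ - a • θ) :
    (∀ (σ : T →ₗ[k] T) (α : Ω →ₗ[k] T),
      (∀ (a : A) (x : T), σ (a • x) = a • σ x) →
      (∀ (a : A) (x : T), σ (op a • x) = op a • σ x) →
      (∀ (a : A) (ω : Ω), α (a • ω) = a • α ω) →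
      (∀ (a : A) (ω : Ω), α (op a • ω) = op a • α ω) →
      ∀ (a : A) (ω : Ω),
        (tens θ (a • ω) - σ (tens (a • ω) θ) + α (a • ω)
          = tens (d a) ω + a • (tens θ ω - σ (tens ω θ) + α ω)) ∧
        (tens θ (op a • ω) - σ (tens (op a • ω) θ) + α (op a • ω)
          = op a • (tens θ ω - σ (tens ω θ) + α ω) + σ (tens ω (d a)))) ∧
    (∀ (σ : T →ₗ[k] T) (nabla : Ω →ₗ[k] T),
      (∀ (a : A) (x : T), σ (a • x) = a • σ x) →
      (∀ (a : A) (x : T), σ (op a • x) = op a • σ x) →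
      (∀ (a : A) (ω : Ω), nabla (a • ω) = tens (d a) ω + a • nabla ω) →
      (∀ (a : A) (ω : Ω), nabla (op a • ω) = op a • nabla ω + σ (tens ω (d a))) →
      ∀ (a : A) (ω : Ω),
        (nabla (a • ω) - tens θ (a • ω) + σ (tens (a • ω) θ)
          = a • (nabla ω - tens θ ω + σ (tens ω θ))) ∧
        (nabla (op a • ω) - tens θ (op a • ω) + σ (tens (op a • ω) θ)
          = op a • (nabla ω - tens θ ω + σ (tens ω θ)))) := by
  refine ⟨fun σ α h1 h2 h3 h4 a ω => ⟨?_, ?_⟩, fun σ nabla h1 h2 h3 h4 a ω => ⟨?_, ?_⟩⟩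
  · simp only [hd, map_sub, LinearMap.sub_apply, htens_left, htens_bal, h1, h3, smul_add, smul_sub]
    abel
  · simp only [hd, map_sub, htens_bal, htens_right, h2, h4, smul_add, smul_sub]
    abel
  · simp only [h3, hd, map_sub, LinearMap.sub_apply, htens_left, htens_bal, h1, smul_add, smul_sub]
    abel
  · simp only [h4, hd, map_sub, htens_bal, htens_right, h2, smul_add, smul_sub]
    abel
end

section
/- Let A be an algebra over a field k, Ω¹ an A-bimodule, θ ∈ Ω¹, d(a) = θa − aθ; let Ω² be an A-bimodule, ∧ : Ω¹ ⊗_A Ω¹ → Ω² an A-bimodule map, and suppose d₁ : Ω¹ → Ω² satisfies d₁ω = θ ∧ ω + ω ∧ θ for all ω ∈ Ω¹. Let (∇, σ) be the bimodule connection given by bimodule maps (σ, α) via ∇ω = θ ⊗ ω − σ(ω ⊗ θ) + α(ω), and T_∇ = ∧∘∇ − d₁. Then: (1) T_∇ω = −∧((id + σ)(ω ⊗ θ)) + ∧(α(ω)) for all ω ∈ Ω¹; (2) if ∧((id+σ)(ω ⊗ θ)) = 0 for all ω ∈ Ω¹ and ∧∘α = 0, then T_∇ = 0; (3) conversely, if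 θ lies in the standard part Ω̄¹ (the left A-span of {a·db : a, b ∈ A}) and T_∇ = 0, then ∧((id+σ)(ω ⊗ θ)) = 0 for all ω ∈ Ω¹ and ∧∘α = 0. -/
open MulOpposite

/-- Let `A` be an algebra over a field `k`, `Ω¹` an `A`-bimodule,
`θ ∈ Ω¹`, `d a = θa - aθ`; let `Ω²` be an `A`-bimodule, `∧ : Ω¹ ⊗_A Ω¹ → Ω²` an
`A`-bimodule map and `d₁ ω = θ∧ω + ω∧θ`.  Let `(∇, σ)` be the bimodule connection
given by bimodule maps `(σ, α)` via `∇ω = θ ⊗ ω - σ(ω ⊗ θ) + α ω`, and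
`T_∇ = ∧∘∇ - d₁` the torsion.  Then:
(1) `T_∇ ω = -∧((id + σ)(ω ⊗ θ)) + ∧(α ω)`;
(2) if `∧((id+σ)(ω ⊗ θ)) = 0` for all `ω` and `∧∘α = 0`, then `T_∇ = 0`;
(3) conversely, if `θ` lies in the standard part `Ω̄¹` (the left `A`-span of
`{a·db}`, i.e. the `A`-span of the range of `d`) and `T_∇ = 0`, then
`∧((id+σ)(ω ⊗ θ)) = 0` for all `ω` and `∧∘α = 0`. -/
theorem statement_12 {k : Type*} [Field k] {A : Type*} [Ring A] [Algebra k A]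
    {Ω1 : Type*} [AddCommGroup Ω1] [Module k Ω1] [Module A Ω1] [Module Aᵐᵒᵖ Ω1]
    [SMulCommClass A Aᵐᵒᵖ Ω1]
    {T2 : Type*} [AddCommGroup T2] [Module k T2] [Module A T2] [Module Aᵐᵒᵖ T2]
    [SMulCommClass A Aᵐᵒᵖ T2]
    {Ω2 : Type*} [AddCommGroup Ω2] [Module k Ω2] [Module A Ω2] [Module Aᵐᵒᵖ Ω2]
    [SMulCommClass A Aᵐᵒᵖ Ω2]
    (θ : Ω1) (d : A → Ω1) (hd : ∀ a : A, d a = op a • θ - a • θ)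
    (tens : Ω1 →ₗ[k] Ω1 →ₗ[k] T2)
    (htens_left : ∀ (a : A) (ω η : Ω1), tens (a • ω) η = a • tens ω η)
    (htens_bal : ∀ (a : A) (ω η : Ω1), tens (op a • ω) η = tens ω (a • η))
    (htens_right : ∀ (a : A) (ω η : Ω1), tens ω (op a • η) = op a • tens ω η)
    (wedge : T2 →ₗ[k] Ω2)
    (hwedge_left : ∀ (a : A) (x : T2), wedge (a • x) = a • wedge x)
    (hwedge_right : ∀ (a : A) (x : T2), wedge (op a • x) = op a • wedge x)
    (σ : T2 →ₗ[k] T2)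
    (hσ_left : ∀ (a : A) (x : T2), σ (a • x) = a • σ x)
    (hσ_right : ∀ (a : A) (x : T2), σ (op a • x) = op a • σ x)
    (α : Ω1 →ₗ[k] T2)
    (hα_left : ∀ (a : A) (ω : Ω1), α (a • ω) = a • α ω)
    (hα_right : ∀ (a : A) (ω : Ω1), α (op a • ω) = op a • α ω)
    (nabla : Ω1 → T2)
    (hnabla : ∀ ω : Ω1, nabla ω = tens θ ω - σ (tens ω θ) + α ω)
    (d1 : Ω1 → Ω2)
    (hd1 : ∀ ω : Ω1, d1 ω = wedge (tens θ ω) + wedge (tens ω θ))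
    (T : Ω1 → Ω2) (hT : ∀ ω : Ω1, T ω = wedge (nabla ω) - d1 ω) :
    (∀ ω : Ω1, T ω = -(wedge (tens ω θ + σ (tens ω θ))) + wedge (α ω)) ∧
    (((∀ ω : Ω1, wedge (tens ω θ + σ (tens ω θ)) = 0) ∧
      (∀ ω : Ω1, wedge (α ω) = 0)) → ∀ ω : Ω1, T ω = 0) ∧
    (θ ∈ Submodule.span A (Set.range d) →
      (∀ ω : Ω1, T ω = 0) →
      (∀ ω : Ω1, wedge (tens ω θ + σ (tens ω θ)) = 0) ∧
      (∀ ω : Ω1, wedge (α ω) = 0)) := by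
  have h1 : ∀ ω : Ω1, T ω = -(wedge (tens ω θ + σ (tens ω θ))) + wedge (α ω) := by
    intro ω
    rw [hT, hnabla, hd1]
    simp only [map_add, map_sub]
    abel
  refine ⟨h1, ?_, ?_⟩
  · rintro ⟨h, h'⟩ ω
    rw [h1, h, h', neg_zero, add_zero]
  · intro hθ hT0
    have h2 : ∀ ω : Ω1, wedge (tens ω θ + σ (tens ω θ)) = wedge (α ω) := by
      intro ω
      have h := h1 ω
      rw [hT0] at h
      exact (neg_add_eq_zero.mp h.symm)
    have key : ∀ η ∈ Submodule.span A (Set.range d),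
        ∀ ω : Ω1, wedge (tens ω η + σ (tens ω η)) = 0 := by
      intro η hη
      induction hη using Submodule.span_induction with
      | mem x hx =>
        obtain ⟨a, rfl⟩ := hx
        intro ω
        have e : wedge (tens ω (d a) + σ (tens ω (d a)))
            = op a • wedge (tens ω θ + σ (tens ω θ))
              - wedge (tens (op a • ω) θ + σ (tens (op a • ω) θ)) := by
          rw [hd, map_sub, htens_right, htens_bal, ← hwedge_right, smul_add, ← hσ_right,
            ← map_sub, map_sub σ]
          congr 1
          abel
        rw [e, h2, h2, hα_right, hwedge_right, sub_self]
      | zero => intro ω; simp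
      | add x y _ _ hx hy =>
        intro ω
        have hx' := hx ω
        have hy' := hy ω
        have e : tens ω (x + y) + σ (tens ω (x + y))
            = (tens ω x + σ (tens ω x)) + (tens ω y + σ (tens ω y)) := by
          simp only [map_add]
          abel
        rw [e, map_add, hx', hy', add_zero]
      | smul a x _ hx =>
        intro ω
        rw [← htens_bal]
        exact hx _
    exact ⟨key θ hθ, fun ω => by rw [← h2]; exact key θ hθ ω⟩
end

section
/- Let k be a field, G a finite group acting freely on the right on a finite set X, let C̄ ⊆ G∖{e}, and let E ⊆ X × X be a set of directed arrows preserved by the diagonal action of G (if (x,y) ∈ E then (x·g, y·g) ∈ E for all g ∈ G). Define the k-linear map ver from the free k-module on E to the space of functions (X → k) ⊗ (C̄ → k) by ver(x,y) = Σ_{a ∈ C̄, y = x·a} δ_x ⊗ δ_a (by freeness this sum has at most one term). Then: (1) every arrow (x,y) ∈ E with y not in the orbit x·G lies in ker(ver); (2) ker(ver) equals exactly the span of the arrows joining distinct orbits if and only if every arrow (x,y) ∈ E with y ∈ x·G satisfies y = x·a for some a ∈ C̄; (3) given (2), ver is surjective if and only if for every x ∈ X and a ∈ C̄ the arrow (x,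 x·a) lies in E. -/
/-- Let `G` be a finite group acting freely on the right on a finite
set `X` (action `act`), `C̄ ⊆ G∖{e}`, and `E ⊆ X × X` a set of arrows preserved by the
diagonal action.  Let `ver` be the linear map from the free `k`-module on `E` to
`(X → k) ⊗ (C̄ → k)` (functions on `X × C̄`) with
`ver (x,y) = ∑_{a ∈ C̄, y = x·a} δ_x ⊗ δ_a`.  Then:
(1) every arrow `(x,y)` with `y` not in the orbit of `x` lies in `ker ver`;
(2) `ker ver` equals the span of the arrows joining distinct orbits iff every arrow
`(x,y)` with `y ∈ x·G` satisfies `y = x·a` for some `a ∈ C̄`;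
(3) given the condition in (2), `ver` is surjective iff `(x, x·a) ∈ E` for every
`x ∈ X` and `a ∈ C̄`. -/
theorem statement_14 {k : Type*} [Field k] {G : Type*} [Group G] [Fintype G]
    [DecidableEq G] {X : Type*} [Fintype X] [DecidableEq X]
    (act : X → G → X)
    (hact_one : ∀ x : X, act x 1 = x)
    (hact_mul : ∀ (x : X) (g h : G), act (act x g) h = act x (g * h))
    (hfree : ∀ (x : X) (g : G), act x g = x → g = 1)
    (Cbar : Finset G) (hCbar : (1 : G) ∉ Cbar)
    (E : Finset (X × X))
    (hE_cov : ∀ p ∈ E, ∀ g : G, (act p.1 g, act p.2 g) ∈ E)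
    (ver : ({p : X × X // p ∈ E} →₀ k) →ₗ[k] (X × {a : G // a ∈ Cbar} → k))
    (hver : ∀ p : {q : X × X // q ∈ E},
      ver (Finsupp.single p 1) =
        fun xa => if p.1.1 = xa.1 ∧ p.1.2 = act xa.1 xa.2.1 then 1 else 0) :
    (∀ p : {q : X × X // q ∈ E}, (¬∃ g : G, p.1.2 = act p.1.1 g) →
      ver (Finsupp.single p 1) = 0) ∧
    ((LinearMap.ker ver =
        Submodule.span k {w : {q : X × X // q ∈ E} →₀ k |
          ∃ p : {q : X × X // q ∈ E}, (¬∃ g : G, p.1.2 = act p.1.1 g) ∧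
            w = Finsupp.single p 1}) ↔
      (∀ p ∈ E, (∃ g : G, p.2 = act p.1 g) → ∃ a ∈ Cbar, p.2 = act p.1 a)) ∧
    ((∀ p ∈ E, (∃ g : G, p.2 = act p.1 g) → ∃ a ∈ Cbar, p.2 = act p.1 a) →
      (Function.Surjective ver ↔ ∀ x : X, ∀ a ∈ Cbar, (x, act x a) ∈ E)) := by
  have hinj : ∀ (x : X) (a b : G), act x a = act x b → a = b := by
    intro x a b h
    have h1 : act x (a * b⁻¹) = x := by
      rw [← hact_mul, h, hact_mul, mul_inv_cancel, hact_one]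
    exact mul_inv_eq_one.mp (hfree _ _ h1)
  have key : ∀ (w : {q : X × X // q ∈ E} →₀ k) (x : X) (a : {a : G // a ∈ Cbar}),
      ver w (x, a) = if h : (x, act x a.1) ∈ E then w ⟨(x, act x a.1), h⟩ else 0 := by
    intro w x a
    induction w using Finsupp.induction_linear with
    | zero => simp
    | add f g hf hg =>
      rw [map_add, Pi.add_apply, hf, hg]
      split_ifs <;> simp
    | single p c =>
      have h1 : Finsupp.single p c = c • Finsupp.single p (1 : k) := by simp
      rw [h1, map_smul, Pi.smul_apply, hver]
      obtain ⟨⟨y, z⟩, hp⟩ := p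
      by_cases hc : y = x ∧ z = act x a.1
      · obtain ⟨rfl, rfl⟩ := hc
        simp [hp]
      · have hc2 : ¬ ((y, z) = (x, act x a.1)) := by simpa using hc
        simp only [hc, if_false, smul_zero]
        split_ifs with h
        · rw [Finsupp.smul_apply, Finsupp.single_eq_of_ne, smul_zero]
          intro h2
          exact hc2 (congrArg Subtype.val h2).symm
        · rfl
  have part1 : ∀ p : {q : X × X // q ∈ E}, (¬∃ g : G, p.1.2 = act p.1.1 g) →
      ver (Finsupp.single p 1) = 0 := by
    intro p hp
    rw [hver]
    funext xa
    simp only [Pi.zero_apply]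
    rw [if_neg]
    rintro ⟨h1, h2⟩
    exact hp ⟨xa.2.1, by rw [h1]; exact h2⟩
  refine ⟨part1, ⟨?_, ?_⟩, ?_⟩
  · intro hker p hpE hg
    by_contra hno
    have hmem : Finsupp.single (⟨p, hpE⟩ : {q : X × X // q ∈ E}) (1 : k) ∈ LinearMap.ker ver := by
      rw [LinearMap.mem_ker, hver]
      funext xa
      simp only [Pi.zero_apply]
      rw [if_neg]
      rintro ⟨h1, h2⟩
      exact hno ⟨xa.2.1, xa.2.2, by rw [h1]; exact h2⟩
    rw [hker] at hmem
    have hle : Submodule.span k {w : {q : X × X // q ∈ E} →₀ k |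
          ∃ p : {q : X × X // q ∈ E}, (¬∃ g : G, p.1.2 = act p.1.1 g) ∧
            w = Finsupp.single p 1} ≤
        LinearMap.ker (Finsupp.lapply (R := k) (⟨p, hpE⟩ : {q : X × X // q ∈ E})) := by
      rw [Submodule.span_le]
      rintro w ⟨q, hq, rfl⟩
      rw [SetLike.mem_coe, LinearMap.mem_ker, Finsupp.lapply_apply, Finsupp.single_eq_of_ne]
      rintro rfl
      exact hq hg
    have := hle hmem
    simp at this
  · intro hcond
    apply le_antisymm
    · intro w hw
      rw [LinearMap.mem_ker] at hw
      rw [← Finsupp.sum_single w]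
      refine Submodule.sum_mem _ fun p _ => ?_
      by_cases hp : ∃ g : G, p.1.2 = act p.1.1 g
      · obtain ⟨a, ha, h2⟩ := hcond p.1 p.2 hp
        have h3 := key w p.1.1 ⟨a, ha⟩
        have h4 : (p.1.1, act p.1.1 a) = p.1 := by rw [← h2]
        have h5 : (p.1.1, act p.1.1 a) ∈ E := by rw [h4]; exact p.2
        have h6 : (⟨(p.1.1, act p.1.1 a), h5⟩ : {q : X × X // q ∈ E}) = p := Subtype.ext h4
        rw [hw, dif_pos h5, h6] at h3
        have h7 : w p = 0 := h3.symm
        simp [h7]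
      · have h1 : Finsupp.single p (w p) = w p • Finsupp.single p (1 : k) := by simp
        simp only [h1]
        exact Submodule.smul_mem _ _ (Submodule.subset_span ⟨p, hp, rfl⟩)
    · rw [Submodule.span_le]
      rintro w ⟨q, hq, rfl⟩
      exact part1 q hq
  · intro _
    constructor
    · intro hs x a ha
      obtain ⟨w, hw⟩ := hs (fun _ => 1)
      have h3 := key w x ⟨a, ha⟩
      by_contra hn
      rw [hw, dif_neg hn] at h3
      exact one_ne_zero h3
    · intro hall f
      let i : X × {a : G // a ∈ Cbar} → {q : X × X // q ∈ E} :=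
        fun xa => ⟨(xa.1, act xa.1 xa.2.1), hall xa.1 xa.2.1 xa.2.2⟩
      have hi : Function.Injective i := by
        rintro ⟨x, a⟩ ⟨y, b⟩ h
        have h1 := congrArg Subtype.val h
        simp only [i, Prod.mk.injEq] at h1
        obtain ⟨rfl, h2⟩ := h1
        rw [Subtype.ext (hinj _ _ _ h2)]
      refine ⟨Finsupp.equivFunOnFinite.symm (Function.extend i f 0), ?_⟩
      funext ⟨x, a⟩
      rw [key, dif_pos (hall x a.1 a.2)]
      exact hi.extend_apply f 0 (x, a)
end

section
/- Let k be a field, G a finite group, and Λ = ⊕_{g∈G} Λ_g a G-graded k-vector space with component projections v ↦ v_g. Suppose given elements ω_h ∈ Λ_h for each h ∈ G∖{e} and an arbitrary θ_e ∈ Λ_e. Let Ω = (G → k) ⊗_k Λ with left action f·(δ_y ⊗ v) = f(y) δ_y ⊗ v and right action (δ_y ⊗ v)·f = Σ_{g∈G} f(yg) δ_y ⊗ v_g, for f ∈ A = k(G). Set Θ = Σ_{y∈G} δ_y ⊗ (θ_e + Σ_{h≠e} ω_h) ∈ Ω. Then for every x ∈ G the commutator Θ·δ_x − δ_x·Θ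 equals Σ_{h∈G, h≠e} (δ_{xh⁻¹} − δ_x) ⊗ ω_h; in particular it is independent of the choice of θ_e, and the map d : A → Ω defined by df = Σ_{h≠e} (R_h f − f) ⊗ ω_h (where (R_h f)(x) = f(xh)) is the inner derivation d f = Θ·f − f·Θ and satisfies the Leibniz rule d(f f') = f·(d f') + (d f)·f' and d(1) = 0. -/
/-- Let `G` be a finite group and `Λ = ⊕_{g ∈ G} Λ_g` a `G`-graded
`k`-vector space, encoded by its component projections `π g` (summing to the identity
and pairwise orthogonal).  Given `ω h ∈ Λ_h` for `h ≠ e` and an arbitrary `θe ∈ Λ_e`,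
consider `Ω = k(G) ⊗ Λ` modelled as `G → Λ`, with left action `(f·w) y = f y • w y` and
right action `(w·f) y = ∑_g f (y g) • π g (w y)`, and set
`Θ = ∑_y δ_y ⊗ (θe + ∑_{h ≠ e} ω h)` (the constant function).  Then
`Θ·δ_x - δ_x·Θ = ∑_{h ≠ e} (δ_{x h⁻¹} - δ_x) ⊗ ω h` for every `x` (in particular
independent of `θe`), and `d f = ∑_{h ≠ e} (R_h f - f) ⊗ ω h` is the inner derivation
`d f = Θ·f - f·Θ`, satisfies the Leibniz rule and `d 1 = 0`. -/
theorem statement_15 {k : Type*} [Field k] {G : Type*} [Group G] [Fintype G] [DecidableEq G]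
    {Λ : Type*} [AddCommGroup Λ] [Module k Λ]
    (π : G → Λ →ₗ[k] Λ)
    (hπ_sum : ∀ v : Λ, ∑ g : G, π g v = v)
    (hπ_orth : ∀ g h : G, g ≠ h → ∀ v : Λ, π g (π h v) = 0)
    (ω : G → Λ) (hω : ∀ h : G, h ≠ 1 → π h (ω h) = ω h)
    (θe : Λ) (hθe : π 1 θe = θe)
    (Θ : G → Λ) (hΘ : ∀ y : G, Θ y = θe + ∑ h : G, (if h = 1 then 0 else ω h))
    (rmul : (G → Λ) → (G → k) → (G → Λ))
    (hrmul : ∀ (w : G → Λ) (f : G → k) (y : G),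
      rmul w f y = ∑ g : G, f (y * g) • π g (w y))
    (lmul : (G → k) → (G → Λ) → (G → Λ))
    (hlmul : ∀ (f : G → k) (w : G → Λ) (y : G), lmul f w y = f y • w y)
    (delta : G → G → k) (hdelta : ∀ x y : G, delta x y = if y = x then 1 else 0)
    (d : (G → k) → (G → Λ))
    (hd : ∀ (f : G → k) (y : G),
      d f y = ∑ h : G, (if h = 1 then 0 else (f (y * h) - f y) • ω h)) :
    (∀ x y : G, rmul Θ (delta x) y - lmul (delta x) Θ y =
        ∑ h : G, (if h = 1 then 0 else (delta (x * h⁻¹) y - delta x y) • ω h)) ∧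
    (∀ (f : G → k) (y : G), d f y = rmul Θ f y - lmul f Θ y) ∧
    (∀ (f f' : G → k) (y : G), d (f * f') y = lmul f (d f') y + rmul (d f) f' y) ∧
    d (fun _ => 1) = 0 := by
  have hW : ∃ W : G → Λ, W 1 = 0 ∧ (∀ h, h ≠ 1 → W h = ω h) ∧ ∀ h, π h (W h) = W h := by
    refine ⟨fun h => if h = 1 then 0 else ω h, by simp, fun h hh => by simp [hh], fun h => ?_⟩
    by_cases hh : h = 1
    · simp [hh]
    · simp [hh, hω h hh]
  obtain ⟨W, hW1, hWω, hWπ⟩ := hW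
  have hif : ∀ (c : G → k) (h : G), (if h = 1 then 0 else c h • ω h) = c h • W h := by
    intro c h
    by_cases hh : h = 1
    · simp [hh, hW1]
    · simp [hh, hWω h hh]
  have hif1 : ∀ h : G, (if h = 1 then 0 else ω h) = W h := by
    intro h
    simpa using hif (fun _ => 1) h
  have hπW : ∀ g h : G, π g (W h) = if g = h then W h else 0 := by
    intro g h
    by_cases hgh : g = h
    · subst hgh
      simp [hWπ]
    · rw [if_neg hgh, ← hWπ h, hπ_orth g h hgh]
  have hπθ : ∀ g : G, π g θe = if g = 1 then θe else 0 := by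
    intro g
    by_cases hg : g = 1
    · subst hg
      simp [hθe]
    · rw [if_neg hg, ← hθe, hπ_orth g 1 hg]
  have key : ∀ (c : G → k) (g : G), π g (∑ h : G, c h • W h) = c g • W g := by
    intro c g
    simp [map_sum, hπW]
  have hd' : ∀ (f : G → k) (y : G), d f y = ∑ h : G, (f (y * h) - f y) • W h := by
    intro f y
    rw [hd]
    exact Finset.sum_congr rfl fun h _ => hif (fun h => f (y * h) - f y) h
  have hinner : ∀ (f : G → k) (y : G), d f y = rmul Θ f y - lmul f Θ y := by
    intro f y
    have h1 : ∀ g : G, π g (Θ y) = (if g = 1 then θe else 0) + W g := by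
      intro g
      rw [hΘ, map_add, hπθ, Finset.sum_congr rfl fun h _ => hif1 h]
      simpa using key (fun _ => 1) g
    rw [hd', hrmul, hlmul, Finset.sum_congr rfl fun g _ => congrArg (f (y * g) • ·) (h1 g), hΘ,
      Finset.sum_congr rfl fun h _ => hif1 h]
    simp only [smul_add, Finset.sum_add_distrib, sub_smul, Finset.sum_sub_distrib,
      Finset.smul_sum, smul_ite, smul_zero, Finset.sum_ite_eq', Finset.mem_univ, if_true, mul_one]
    abel
  refine ⟨?_, hinner, ?_, ?_⟩
  · intro x y
    rw [← hinner, hd]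
    refine Finset.sum_congr rfl fun h _ => ?_
    simp only [hdelta, eq_mul_inv_iff_mul_eq]
  · intro f f' y
    rw [hlmul, hrmul, hd', hd', hd', Finset.smul_sum, ← Finset.sum_add_distrib]
    refine Finset.sum_congr rfl fun h _ => ?_
    rw [key (fun h => f (y * h) - f y) h, smul_smul, smul_smul, ← add_smul]
    congr 1
    simp only [Pi.mul_apply]
    ring
  · funext y
    rw [hd']
    simp
end
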